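/- For β ∈ (0,1), the function f_β(t) = ∫₀^∞ θ e^{-θt} K_β(θ) dθ, with K_β(θ) = (1/π)θ^{β-1}sin(βπ)/(θ^{2β} + 2θ^β cos(βπ) + 1), has Laplace transform ∫₀^∞ e^{-st} f_β(t) dt = 1/(1 + s^β) for s > 0. -/

import Mathlib

noncomputable def Kβ (β θ : ℝ) : ℝ :=
  (1 / Real.pi) * θ ^ (β - 1) * Real.sin (β * Real.pi) /
    (θ ^ (2 * β) + 2 * θ ^ β * Real.cos (β * Real.pi) + 1)

noncomputable def fβ (β t : ℝ) : ℝ := ∫ θ in Set.Ioi (0:ℝ), θ * Real.exp (-θ * t) * Kβ β θ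

open MeasureTheory Filter Topology Set

noncomputable def mlG (β : ℝ) (w : ℂ) : ℂ := (1 + Complex.exp ((β : ℂ) * w))⁻¹

noncomputable def mlF (β a : ℝ) (w : ℂ) : ℂ :=
  Complex.exp w * dslope (mlG β) (a : ℂ) w / dslope Complex.exp (a : ℂ) w

def mlS : Set ℂ := {w | |w.im| ≤ Real.pi}

theorem mlS_nhds (a : ℝ) : mlS ∈ 𝓝 (a : ℂ) := by
  have h : {w : ℂ | |w.im| < Real.pi} ∈ 𝓝 (a : ℂ) := by
    apply IsOpen.mem_nhds
    · exact isOpen_lt (Complex.continuous_im.abs) continuous_const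
    · simp [Real.pi_pos]
  filter_upwards [h] with w hw
  exact le_of_lt hw

theorem ml_den_ne {β : ℝ} (hβ : β ∈ Ioo (0:ℝ) 1) {w : ℂ} (hw : w ∈ mlS) :
    1 + Complex.exp ((β : ℂ) * w) ≠ 0 := by
  intro h
  have h1 : Complex.exp ((β : ℂ) * w) = Complex.exp (Real.pi * Complex.I) := by
    rw [Complex.exp_pi_mul_I]; linear_combination h
  obtain ⟨n, hn⟩ := Complex.exp_eq_exp_iff_exists_int.1 h1
  have h2 : β * w.im = Real.pi + n * (2 * Real.pi) := by
    simpa using congrArg Complex.im hn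
  have hw' : |w.im| ≤ Real.pi := hw
  have hpi := Real.pi_pos
  have h3 : |β * w.im| < Real.pi := by
    rw [abs_mul, abs_of_pos hβ.1]
    nlinarith [hβ.1, hβ.2, abs_nonneg w.im]
  rw [h2, abs_lt] at h3
  have h4 : (-1 : ℝ) < n := by nlinarith [h3.1]
  have h5 : (n : ℝ) < 0 := by nlinarith [h3.2]
  have h4' : (-1 : ℤ) < n := by exact_mod_cast h4
  have h5' : n < 0 := by exact_mod_cast h5
  omega

theorem ml_exp_ne {a : ℝ} {w : ℂ} (hw : w ∈ mlS) (hne : w ≠ a) :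
    Complex.exp w ≠ Complex.exp a := by
  intro h
  obtain ⟨n, hn⟩ := Complex.exp_eq_exp_iff_exists_int.1 h
  have h2 : w.im = n * (2 * Real.pi) := by
    simpa using congrArg Complex.im hn
  have hw' : |w.im| ≤ Real.pi := hw
  have hpi := Real.pi_pos
  rw [h2, abs_le] at hw'
  have h4 : (-1 : ℝ) < n := by nlinarith [hw'.1]
  have h5 : (n : ℝ) < 1 := by nlinarith [hw'.2]
  have h4' : (-1 : ℤ) < n := by exact_mod_cast h4
  have h5' : n < 1 := by exact_mod_cast h5
  have : n = 0 := by omega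
  apply hne
  rw [hn, this]; simp

theorem mlG_diff {β : ℝ} (hβ : β ∈ Ioo (0:ℝ) 1) : DifferentiableOn ℂ (mlG β) mlS := by
  intro w hw
  unfold mlG
  apply DifferentiableAt.differentiableWithinAt
  exact DifferentiableAt.fun_inv (by fun_prop) (ml_den_ne hβ hw)

theorem ml_dslope_exp_ne {a : ℝ} {w : ℂ} (hw : w ∈ mlS) :
    dslope Complex.exp (a : ℂ) w ≠ 0 := by
  by_cases h : w = a
  · subst h
    rw [dslope_same]
    simp [Complex.exp_ne_zero]
  · rw [dslope_of_ne _ h, slope_def_field]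
    exact div_ne_zero (sub_ne_zero.2 (ml_exp_ne hw h)) (sub_ne_zero.2 h)

theorem mlF_diff {β : ℝ} (hβ : β ∈ Ioo (0:ℝ) 1) (a : ℝ) : DifferentiableOn ℂ (mlF β a) mlS := by
  unfold mlF
  apply DifferentiableOn.div
  · apply DifferentiableOn.mul Complex.differentiable_exp.differentiableOn
    exact (Complex.differentiableOn_dslope (mlS_nhds a)).2 (mlG_diff hβ)
  · exact (Complex.differentiableOn_dslope (mlS_nhds a)).2 Complex.differentiable_exp.differentiableOn
  · intro w hw
    exact ml_dslope_exp_ne hw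

noncomputable def mlH (β a : ℝ) (w : ℂ) : ℂ :=
  (mlG β w - mlG β a) * (Complex.exp w / (Complex.exp w - Complex.exp a))

theorem mlF_eq (β : ℝ) {a : ℝ} {w : ℂ} (hw : w ∈ mlS) (hne : w ≠ a) :
    mlF β a w = mlH β a w := by
  unfold mlF mlH
  rw [dslope_of_ne _ hne, dslope_of_ne _ hne, slope_def_field, slope_def_field]
  have h1 := sub_ne_zero.2 hne
  have h2 := sub_ne_zero.2 (ml_exp_ne hw hne)
  field_simp

theorem mlH_top {β : ℝ} (hβ : 0 < β) (a : ℝ) :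
    Tendsto (mlH β a) (comap Complex.re atTop) (𝓝 (-mlG β a)) := by
  have hG : Tendsto (mlG β) (comap Complex.re atTop) (𝓝 0) := by
    unfold mlG
    apply Filter.tendsto_inv₀_cobounded.comp
    have h1 : Tendsto (fun w : ℂ => (β : ℂ) * w) (comap Complex.re atTop) (comap Complex.re atTop) := by
      rw [tendsto_comap_iff]
      have : Complex.re ∘ (fun w : ℂ => (β : ℂ) * w) = fun w => β * w.re := by
        ext w; simp
      rw [this]
      exact tendsto_comap.const_mul_atTop hβ
    have h2 := Complex.tendsto_exp_comap_re_atTop.comp h1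
    rw [← tendsto_norm_atTop_iff_cobounded] at h2 ⊢
    have h3 := tendsto_atTop_add_const_right _ (-1 : ℝ) h2
    apply tendsto_atTop_mono _ h3
    intro w
    have := norm_sub_norm_le (Complex.exp ((β : ℂ) * w)) (-1)
    simp only [norm_neg, norm_one, sub_neg_eq_add, Function.comp] at this ⊢
    rw [add_comm 1]
    linarith
  have hE : Tendsto (fun w => Complex.exp w / (Complex.exp w - Complex.exp a))
      (comap Complex.re atTop) (𝓝 1) := by
    have h1 : Tendsto (fun w => (1 - Complex.exp a * (Complex.exp w)⁻¹)⁻¹)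
        (comap Complex.re atTop) (𝓝 ((1 - Complex.exp a * 0)⁻¹)) := by
      apply Tendsto.inv₀ _ (by simp)
      exact tendsto_const_nhds.sub
        ((Filter.tendsto_inv₀_cobounded.comp Complex.tendsto_exp_comap_re_atTop).const_mul _)
    simp only [mul_zero, sub_zero, inv_one] at h1
    refine h1.congr fun w => ?_
    have h0 := Complex.exp_ne_zero w
    rw [inv_eq_one_div, ← mul_div_mul_left _ _ h0]
    congr 1
    · ring
    · field_simp
  have := (hG.sub_const (mlG β a)).mul hE
  unfold mlH
  simpa using this

theorem mlH_bot {β : ℝ} (hβ : 0 < β) (a : ℝ) :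
    Tendsto (mlH β a) (comap Complex.re atBot) (𝓝 0) := by
  have hE0 : Tendsto Complex.exp (comap Complex.re atBot) (𝓝 0) :=
    Complex.tendsto_exp_comap_re_atBot
  have hG : Tendsto (mlG β) (comap Complex.re atBot) (𝓝 (1 + 0)⁻¹) := by
    unfold mlG
    have h1 : Tendsto (fun w : ℂ => (β : ℂ) * w) (comap Complex.re atBot) (comap Complex.re atBot) := by
      rw [tendsto_comap_iff]
      have : Complex.re ∘ (fun w : ℂ => (β : ℂ) * w) = fun w => β * w.re := by
        ext w; simp
      rw [this]
      exact tendsto_comap.const_mul_atBot hβ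
    exact ((hE0.comp h1).const_add 1).inv₀ (by simp)
  have hE : Tendsto (fun w => Complex.exp w / (Complex.exp w - Complex.exp a))
      (comap Complex.re atBot) (𝓝 (0 / (0 - Complex.exp a))) :=
    hE0.div (hE0.sub_const _) (by simp [Complex.exp_ne_zero])
  have := (hG.sub_const (mlG β a)).mul hE
  unfold mlH
  simpa using this

theorem ml_mem {x y : ℝ} (hy : y ∈ uIcc (-Real.pi) Real.pi) : (x + y * Complex.I : ℂ) ∈ mlS := by
  rw [uIcc_of_le (by linarith [Real.pi_pos])] at hy
  simpa [mlS, abs_le] using hy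

/-- limits of integrals over vertical sides -/
theorem ml_vert {β : ℝ} (hβ : β ∈ Ioo (0:ℝ) 1) (a : ℝ) {l : Filter ℝ} [l.IsCountablyGenerated]
    (hl : ∀ᶠ r in l, r ≠ a) {c : ℂ}
    (hH : Tendsto (mlH β a) (comap Complex.re l) (𝓝 c)) :
    Tendsto (fun r : ℝ => ∫ y in (-Real.pi)..Real.pi, mlF β a (r + y * Complex.I)) l
      (𝓝 (2 * Real.pi * c)) := by
  have hb : ∀ᶠ w in comap Complex.re l, ‖mlH β a w‖ ≤ ‖c‖ + 1 := by
    filter_upwards [hH.norm.eventually (Iio_mem_nhds (lt_add_one ‖c‖))] with w hw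
    exact le_of_lt hw
  rw [eventually_comap] at hb
  have key : Tendsto (fun r : ℝ => ∫ y in (-Real.pi)..Real.pi, mlF β a (r + y * Complex.I)) l
      (𝓝 (∫ y in (-Real.pi)..Real.pi, c)) := by
    apply intervalIntegral.tendsto_integral_filter_of_dominated_convergence (fun _ => ‖c‖ + 1)
    · refine Eventually.of_forall fun r => ?_
      apply ContinuousOn.aestronglyMeasurable _ measurableSet_uIoc
      apply (mlF_diff hβ a).continuousOn.comp (by fun_prop)
      intro y hy
      exact ml_mem (uIoc_subset_uIcc hy)
    · filter_upwards [hl, hb] with r hr hbr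
      refine Eventually.of_forall fun y hy => ?_
      rw [mlF_eq β (ml_mem (uIoc_subset_uIcc hy))]
      · exact hbr _ (by simp)
      · intro h
        exact hr (by simpa using congrArg Complex.re h)
    · exact intervalIntegrable_const
    · refine Eventually.of_forall fun y hy => ?_
      have h1 : Tendsto (fun r : ℝ => (r + y * Complex.I : ℂ)) l (comap Complex.re l) := by
        rw [tendsto_comap_iff]
        refine tendsto_id.congr fun r => ?_
        simp
      refine (hH.comp h1).congr' ?_
      filter_upwards [hl] with r hr
      rw [mlF_eq β (ml_mem (uIoc_subset_uIcc hy))]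
      · rfl
      · intro h
        exact hr (by simpa using congrArg Complex.re h)
  rw [intervalIntegral.integral_const] at key
  convert key using 2
  rw [Complex.real_smul]
  push_cast
  ring

noncomputable def mlphi (β s x : ℝ) : ℝ :=
  Real.exp (β * x) * Real.sin (β * Real.pi) /
    (Real.exp (2 * β * x) + 2 * Real.exp (β * x) * Real.cos (β * Real.pi) + 1) *
    (Real.exp x / (Real.exp x + s))

theorem ml_sin_pos {β : ℝ} (hβ : β ∈ Ioo (0:ℝ) 1) : 0 < Real.sin (β * Real.pi) := by
  apply Real.sin_pos_of_pos_of_lt_pi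
  · exact mul_pos hβ.1 Real.pi_pos
  · nlinarith [hβ.2, Real.pi_pos]

theorem ml_real_den {β : ℝ} (hβ : β ∈ Ioo (0:ℝ) 1) (u : ℝ) :
    0 < u ^ 2 + 2 * u * Real.cos (β * Real.pi) + 1 := by
  nlinarith [ml_sin_pos hβ, Real.sin_sq_add_cos_sq (β * Real.pi),
    sq_nonneg (u + Real.cos (β * Real.pi)), pow_pos (ml_sin_pos hβ) 2]

theorem ml_exp_two (β x : ℝ) : Real.exp (2 * β * x) = Real.exp (β * x) ^ 2 := by
  rw [← Real.exp_nat_mul]; congr 1; push_cast; ring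

theorem mlphi_nonneg {β s : ℝ} (hβ : β ∈ Ioo (0:ℝ) 1) (hs : 0 < s) (x : ℝ) :
    0 ≤ mlphi β s x := by
  unfold mlphi
  rw [ml_exp_two]
  have := ml_sin_pos hβ
  have := ml_real_den hβ (Real.exp (β * x))
  positivity

theorem mlphi_cont {β s : ℝ} (hβ : β ∈ Ioo (0:ℝ) 1) (hs : 0 < s) :
    Continuous (mlphi β s) := by
  unfold mlphi
  apply Continuous.mul
  · apply Continuous.div (by fun_prop) (by fun_prop)
    intro x
    rw [ml_exp_two]
    exact (ml_real_den hβ _).ne'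
  · apply Continuous.div (by fun_prop) (by fun_prop)
    intro x
    positivity

theorem ml_jump {β s : ℝ} (hβ : β ∈ Ioo (0:ℝ) 1) (hs : 0 < s) (x : ℝ) :
    mlF β (Real.log s) (x + (-Real.pi : ℝ) * Complex.I) - mlF β (Real.log s) (x + (Real.pi : ℝ) * Complex.I)
      = 2 * Complex.I * (mlphi β s x : ℂ) := by
  have hpi := Real.pi_pos
  have m1 : (x + (-Real.pi : ℝ) * Complex.I : ℂ) ∈ mlS := ml_mem (by simp)
  have m2 : (x + (Real.pi : ℝ) * Complex.I : ℂ) ∈ mlS := ml_mem (by simp)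
  rw [mlF_eq β m1, mlF_eq β m2]
  rotate_left
  · intro h
    have := congrArg Complex.im h
    simp [hpi.ne'] at this
  · intro h
    have := congrArg Complex.im h
    simp [hpi.ne'] at this
  have e1 : Complex.exp (x + (-Real.pi : ℝ) * Complex.I) = -(Real.exp x : ℂ) := by
    rw [Complex.exp_add]; push_cast
    rw [neg_mul, Complex.exp_neg, Complex.exp_pi_mul_I]; norm_num
  have e2 : Complex.exp (x + (Real.pi : ℝ) * Complex.I) = -(Real.exp x : ℂ) := by
    rw [Complex.exp_add, Complex.exp_pi_mul_I]; push_cast; ring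
  have e3 : Complex.exp (Real.log s : ℝ) = (s : ℂ) := by
    rw [← Complex.ofReal_exp, Real.exp_log hs]
  have hd1 := ml_den_ne hβ m1
  have hd2 := ml_den_ne hβ m2
  have f1 : Complex.exp (β * (x + (-Real.pi : ℝ) * Complex.I)) =
      (Real.exp (β * x) : ℂ) * (Real.cos (β * Real.pi) - Real.sin (β * Real.pi) * Complex.I) := by
    rw [mul_add, Complex.exp_add]
    have : (β : ℂ) * ((-Real.pi : ℝ) * Complex.I) = ((-(β * Real.pi) : ℝ) : ℂ) * Complex.I := by
      push_cast; ring
    rw [this, Complex.exp_mul_I, ← Complex.ofReal_cos, ← Complex.ofReal_sin, Real.cos_neg, Real.sin_neg]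
    push_cast; ring
  have f2 : Complex.exp (β * (x + (Real.pi : ℝ) * Complex.I)) =
      (Real.exp (β * x) : ℂ) * (Real.cos (β * Real.pi) + Real.sin (β * Real.pi) * Complex.I) := by
    rw [mul_add, Complex.exp_add]
    have : (β : ℂ) * ((Real.pi : ℝ) * Complex.I) = ((β * Real.pi : ℝ) : ℂ) * Complex.I := by
      push_cast; ring
    rw [this, Complex.exp_mul_I, ← Complex.ofReal_cos, ← Complex.ofReal_sin]
    push_cast; ring
  rw [f1] at hd1
  rw [f2] at hd2
  unfold mlH mlphi mlG
  rw [e1, e2, e3, f1, f2, ml_exp_two]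
  have hD := ml_real_den hβ (Real.exp (β * x))
  have hsc := Real.sin_sq_add_cos_sq (β * Real.pi)
  have hE := Real.exp_pos x
  generalize Real.exp (β * x) = u at *
  generalize Real.cos (β * Real.pi) = c at *
  generalize Real.sin (β * Real.pi) = σ at *
  generalize Real.exp x = E at *
  have hsc' : (σ : ℂ) ^ 2 + (c : ℂ) ^ 2 = 1 := by exact_mod_cast hsc
  have hprod : ((u ^ 2 + 2 * u * c + 1 : ℝ) : ℂ) =
      (1 + (u : ℂ) * (c - σ * Complex.I)) * (1 + (u : ℂ) * (c + σ * Complex.I)) := by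
    push_cast
    linear_combination (-(u : ℂ) ^ 2) * hsc' + (u : ℂ) ^ 2 * σ ^ 2 * Complex.I_sq
  have hES : (E + s : ℂ) ≠ 0 := by
    have : E + s ≠ 0 := by positivity
    exact_mod_cast this
  have q : (-(E : ℂ)) / (-(E : ℂ) - s) = E / (E + s) := by
    rw [← neg_div_neg_eq]; congr 1 <;> ring
  rw [q, Complex.ofReal_mul, Complex.ofReal_div, hprod, ← sub_mul]
  push_cast
  rw [← mul_assoc]
  congr 1
  field_simp
  ring

theorem ml_tendsto {β s : ℝ} (hβ : β ∈ Ioo (0:ℝ) 1) (hs : 0 < s) :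
    Tendsto (fun R : ℝ => ∫ x in (-R)..R, mlphi β s x) atTop (𝓝 (Real.pi * (1 / (1 + s ^ β)))) := by
  set a := Real.log s with ha
  have hr := ml_vert hβ a (eventually_ne_atTop a) (mlH_top hβ.1 a)
  have hl := (ml_vert hβ a (eventually_ne_atBot a) (mlH_bot hβ.1 a)).comp tendsto_neg_atTop_atBot
  have hGa : mlG β a = ((1 / (1 + s ^ β) : ℝ) : ℂ) := by
    unfold mlG
    rw [Real.rpow_def_of_pos hs]
    push_cast
    rw [mul_comm, one_div]
  have hrect : ∀ R : ℝ, ((∫ x in (-R)..R, mlphi β s x : ℝ) : ℂ) =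
      -(1/2) * (∫ y in (-Real.pi)..Real.pi, mlF β a (R + y * Complex.I)) +
      (1/2) * (∫ y in (-Real.pi)..Real.pi, mlF β a ((-R : ℝ) + y * Complex.I)) := by
    intro R
    have h := Complex.integral_boundary_rect_eq_zero_of_differentiableOn (mlF β a)
      ⟨-R, -Real.pi⟩ ⟨R, Real.pi⟩ ((mlF_diff hβ a).mono (by
        intro w hw
        have := ml_mem (x := w.re) hw.2
        rwa [Complex.re_add_im] at this))
    simp only [smul_eq_mul] at h
    have hi : ∀ y : ℝ, y ∈ uIcc (-Real.pi) Real.pi →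
        IntervalIntegrable (fun x : ℝ => mlF β a (x + y * Complex.I)) volume (-R) R := by
      intro y hy
      apply ContinuousOn.intervalIntegrable
      apply (mlF_diff hβ a).continuousOn.comp (by fun_prop)
      intro x _
      exact ml_mem hy
    rw [← intervalIntegral.integral_sub (hi _ (by simp)) (hi _ (by simp))] at h
    simp only [ha] at h
    simp only [ml_jump hβ hs] at h
    rw [intervalIntegral.integral_const_mul, intervalIntegral.integral_ofReal] at h
    have hI := Complex.I_ne_zero
    apply mul_left_cancel₀ (mul_ne_zero two_ne_zero hI)
    simp only [ha]
    linear_combination h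
  have hlim := (hr.const_mul (-(1/2) : ℂ)).add (hl.const_mul (1/2 : ℂ))
  have h2 : Tendsto (fun R : ℝ => ((∫ x in (-R)..R, mlphi β s x : ℝ) : ℂ)) atTop
      (𝓝 ((Real.pi * (1 / (1 + s ^ β)) : ℝ) : ℂ)) := by
    simp only [hrect]
    have hc : ((Real.pi * (1 / (1 + s ^ β)) : ℝ) : ℂ) =
        -(1 / 2) * (2 * Real.pi * -mlG β a) + 1 / 2 * (2 * Real.pi * 0) := by
      rw [hGa]
      push_cast
      ring
    rw [hc]
    exact hlim
  exact (Complex.continuous_re.tendsto _).comp h2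

theorem mlphi_integrable {β s : ℝ} (hβ : β ∈ Ioo (0:ℝ) 1) (hs : 0 < s) :
    Integrable (mlphi β s) := by
  apply integrable_of_intervalIntegral_norm_tendsto (Real.pi * (1 / (1 + s ^ β)))
    (l := atTop) (a := fun R : ℝ => -R) (b := fun R => R)
  · intro R
    exact ((mlphi_cont hβ hs).integrableOn_Icc).mono_set Ioc_subset_Icc_self
  · exact tendsto_neg_atTop_atBot
  · exact tendsto_id
  · simp only [Real.norm_of_nonneg (mlphi_nonneg hβ hs _)]
    exact ml_tendsto hβ hs

theorem mlphi_integral {β s : ℝ} (hβ : β ∈ Ioo (0:ℝ) 1) (hs : 0 < s) :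
    ∫ x, mlphi β s x = Real.pi * (1 / (1 + s ^ β)) :=
  tendsto_nhds_unique (intervalIntegral_tendsto_integral (mlphi_integrable hβ hs)
    tendsto_neg_atTop_atBot tendsto_id) (ml_tendsto hβ hs)

theorem ml_subst {β s : ℝ} (x : ℝ) :
    |Real.exp x| • (Real.exp x * Kβ β (Real.exp x) / (s + Real.exp x)) = 1 / Real.pi * mlphi β s x := by
  unfold Kβ mlphi
  rw [abs_of_pos (Real.exp_pos x), smul_eq_mul, ← Real.exp_mul, ← Real.exp_mul, ← Real.exp_mul,
    show x * (β - 1) = β * x - x by ring, Real.exp_sub, show x * (2 * β) = 2 * β * x by ring,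
    show x * β = β * x by ring, add_comm s]
  have := Real.exp_ne_zero x
  generalize Real.exp (2 * β * x) + 2 * Real.exp (β * x) * Real.cos (β * Real.pi) + 1 = D
  simp only [div_eq_mul_inv]
  field_simp

theorem ml_image : Real.exp '' univ = Ioi 0 := by rw [image_univ, Real.range_exp]

theorem ml_stieltjes {β s : ℝ} (hβ : β ∈ Ioo (0:ℝ) 1) (hs : 0 < s) :
    IntegrableOn (fun θ => θ * Kβ β θ / (s + θ)) (Ioi 0) ∧
    ∫ θ in Ioi (0:ℝ), θ * Kβ β θ / (s + θ) = 1 / (1 + s ^ β) := by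
  have hd : ∀ x ∈ (univ : Set ℝ), HasDerivWithinAt Real.exp (Real.exp x) univ x :=
    fun x _ => (Real.hasDerivAt_exp x).hasDerivWithinAt
  rw [← ml_image, integrableOn_image_iff_integrableOn_abs_deriv_smul MeasurableSet.univ hd
    Real.exp_injective.injOn, integral_image_eq_integral_abs_deriv_smul MeasurableSet.univ hd
    Real.exp_injective.injOn]
  simp only [ml_subst, integrableOn_univ, Measure.restrict_univ]
  refine ⟨(mlphi_integrable hβ hs).const_mul _, ?_⟩
  rw [integral_const_mul, mlphi_integral hβ hs]
  have := Real.pi_pos.ne'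
  field_simp

theorem Kβ_nonneg {β θ : ℝ} (hβ : β ∈ Ioo (0:ℝ) 1) (hθ : 0 < θ) : 0 ≤ Kβ β θ := by
  unfold Kβ
  have h1 := ml_sin_pos hβ
  have h2 := ml_real_den hβ (θ ^ β)
  have h3 : θ ^ (2 * β) = (θ ^ β) ^ 2 := by
    rw [mul_comm, Real.rpow_mul hθ.le]; norm_num
  rw [h3]
  have := Real.pi_pos
  positivity

theorem laplace_mittagLeffler_density (β : ℝ) (hβ : β ∈ Set.Ioo (0:ℝ) 1) (s : ℝ) (hs : 0 < s) :
    ∫ t in Set.Ioi (0:ℝ), Real.exp (-s * t) * fβ β t = 1 / (1 + s ^ β) := by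
  obtain ⟨hint, hval⟩ := ml_stieltjes hβ hs
  unfold fβ
  simp only [← integral_const_mul]
  have hrw : ∀ t θ : ℝ, Real.exp (-s * t) * (θ * Real.exp (-θ * t) * Kβ β θ) =
      θ * Kβ β θ * Real.exp (-(s + θ) * t) := by
    intro t θ
    rw [show -(s + θ) * t = -s * t + -θ * t by ring, Real.exp_add]; ring
  simp only [hrw]
  have hinner : ∀ θ ∈ Ioi (0:ℝ), ∫ t in Ioi (0:ℝ), θ * Kβ β θ * Real.exp (-(s + θ) * t) =
      θ * Kβ β θ / (s + θ) := by
    intro θ hθ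
    have hθ' : 0 < θ := hθ
    rw [integral_const_mul, integral_exp_mul_Ioi (by linarith)]
    rw [mul_zero, Real.exp_zero, neg_div_neg_eq, mul_one_div]
  rw [integral_integral_swap]
  · rw [setIntegral_congr_fun measurableSet_Ioi hinner, hval]
  · rw [integrable_prod_iff']
    · constructor
      · filter_upwards [self_mem_ae_restrict measurableSet_Ioi] with θ hθ
        have hθ' : 0 < θ := hθ
        have hneg : -(s + θ) < 0 := by linarith
        exact (integrableOn_exp_mul_Ioi hneg 0).const_mul (θ * Kβ β θ)
      · refine hint.congr ?_
        filter_upwards [self_mem_ae_restrict measurableSet_Ioi] with θ hθ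
        rw [← hinner θ hθ]
        refine integral_congr_ae (Eventually.of_forall fun t => ?_)
        have hθ' : 0 < θ := hθ
        have := Kβ_nonneg hβ hθ'
        simp only [Function.uncurry]
        rw [Real.norm_of_nonneg (by positivity)]
    · apply Measurable.aestronglyMeasurable
      unfold Function.uncurry Kβ
      fun_prop
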